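/- Quadrilateral case, nonpositive truncated areas (with τ₀ = 0.32, so 4τ₀ = 1.28): (i) for all (ρ, t) with either ρ ∈ [0.1, 0.85] and t ∈ [−1.28, 0], or ρ ∈ [0.1, 1] and t ∈ [−1.28, −0.25], one has I(circPerim0(ρπ/3 − 2t), 4, t, ρ) > 0, i.e., √(4π·a − a²) − t·B' + p₅' − ρ·p₅ > 0 where a = ρπ/3 − 2t; and (ii) for all ρ ∈ [0.85, 1] and t ∈ [−0.25, 0], I(regPerim(ρπ/3 − t, 4), 4, t, ρ) > 0. -/

import Mathlib

open Real

/-- Perimeter of a regular spherical `n`-gon of area `x` on the unit sphere. -/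
noncomputable def regPerim (x n : ℝ) : ℝ :=
  n * Real.arccos ((Real.cos (2 * π / n) +
      (Real.cos ((π - (2 * π - x) / n) / 2)) ^ 2) /
      (Real.sin ((π - (2 * π - x) / n) / 2)) ^ 2)

/-- Circumference of a circle on the unit sphere enclosing area `a`. -/
noncomputable def circPerim0 (a : ℝ) : ℝ := Real.sqrt (4 * π * a - a ^ 2)

/-- Perimeter of the regular spherical pentagon of area `π/3`. -/
noncomputable def p5 : ℝ := 5 * Real.arccos ((4 * Real.cos (2 * π / 5) + 1) / 3)

/-- Derivative at `n = 5` of `n ↦ regPerim (π/3) n`. -/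
noncomputable def p5' : ℝ := deriv (fun n : ℝ => regPerim (π / 3) n) 5

/-- `B' = -∂₁ regPerim (π/3, 5)`. -/
noncomputable def B' : ℝ := - deriv (fun x : ℝ => regPerim x 5) (π / 3)

/-- The isoperimetric functional `I(ℓ, n, t, ρ)`. -/
noncomputable def Ifun (ℓ n t ρ : ℝ) : ℝ := ℓ - t * B' + (5 - n) * p5' - ρ * p5

theorem nonneg_of_deriv_nonneg {f f' : ℝ → ℝ} (hf : ∀ x, HasDerivAt f (f' x) x) (h0 : f 0 = 0)
    (h : ∀ x, 0 ≤ x → 0 ≤ f' x) {x : ℝ} (hx : 0 ≤ x) : 0 ≤ f x := by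
  have hm : MonotoneOn f (Set.Ici 0) := by
    refine monotoneOn_of_deriv_nonneg (convex_Ici 0)
      (fun y _ => (hf y).continuousAt.continuousWithinAt)
      (fun y _ => (hf y).differentiableAt.differentiableWithinAt) ?_
    intro y hy
    rw [(hf y).deriv]
    exact h y (interior_subset hy)
  have := hm (Set.mem_Ici.2 le_rfl) (Set.mem_Ici.2 hx) hx
  rwa [h0] at this

theorem cos_le_taylor_four {x : ℝ} (hx : 0 ≤ x) : cos x ≤ 1 - x ^ 2 / 2 + x ^ 4 / 24 := by
  have key := nonneg_of_deriv_nonneg (f := fun x => 1 - x ^ 2 / 2 + x ^ 4 / 24 - cos x)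
    (f' := fun x => sin x - (x - x ^ 3 / 6))
    (fun y => by
      have := ((((hasDerivAt_const y (1 : ℝ)).sub ((hasDerivAt_pow 2 y).div_const 2)).add
        ((hasDerivAt_pow 4 y).div_const 24)).sub (hasDerivAt_cos y))
      refine this.congr_deriv ?_
      push_cast
      ring)
    (by simp) (fun y hy => sub_nonneg.2 (sin_ge_sub_cube hy)) hx
  exact sub_nonneg.1 key

theorem sin_le_taylor_five {x : ℝ} (hx : 0 ≤ x) : sin x ≤ x - x ^ 3 / 6 + x ^ 5 / 120 := by
  have key := nonneg_of_deriv_nonneg (f := fun x => x - x ^ 3 / 6 + x ^ 5 / 120 - sin x)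
    (f' := fun x => 1 - x ^ 2 / 2 + x ^ 4 / 24 - cos x)
    (fun y => by
      have := ((((hasDerivAt_id y).sub ((hasDerivAt_pow 3 y).div_const 6)).add
        ((hasDerivAt_pow 5 y).div_const 120)).sub (hasDerivAt_sin y))
      refine this.congr_deriv ?_
      push_cast
      ring)
    (by simp) (fun y hy => sub_nonneg.2 (cos_le_taylor_four hy)) hx
  exact sub_nonneg.1 key

theorem taylor_six_le_cos {x : ℝ} (hx : 0 ≤ x) :
    1 - x ^ 2 / 2 + x ^ 4 / 24 - x ^ 6 / 720 ≤ cos x := by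
  have key := nonneg_of_deriv_nonneg
    (f := fun x => cos x - (1 - x ^ 2 / 2 + x ^ 4 / 24 - x ^ 6 / 720))
    (f' := fun x => x - x ^ 3 / 6 + x ^ 5 / 120 - sin x)
    (fun y => by
      have := (hasDerivAt_cos y).sub ((((hasDerivAt_const y (1 : ℝ)).sub
        ((hasDerivAt_pow 2 y).div_const 2)).add ((hasDerivAt_pow 4 y).div_const 24)).sub
        ((hasDerivAt_pow 6 y).div_const 720))
      refine this.congr_deriv ?_
      push_cast
      ring)
    (by simp) (fun y hy => sub_nonneg.2 (sin_le_taylor_five hy)) hx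
  exact sub_nonneg.1 key

theorem taylor_seven_le_sin {x : ℝ} (hx : 0 ≤ x) :
    x - x ^ 3 / 6 + x ^ 5 / 120 - x ^ 7 / 5040 ≤ sin x := by
  have key := nonneg_of_deriv_nonneg
    (f := fun x => sin x - (x - x ^ 3 / 6 + x ^ 5 / 120 - x ^ 7 / 5040))
    (f' := fun x => cos x - (1 - x ^ 2 / 2 + x ^ 4 / 24 - x ^ 6 / 720))
    (fun y => by
      have := (hasDerivAt_sin y).sub ((((hasDerivAt_id y).sub
        ((hasDerivAt_pow 3 y).div_const 6)).add ((hasDerivAt_pow 5 y).div_const 120)).sub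
        ((hasDerivAt_pow 7 y).div_const 5040))
      refine this.congr_deriv ?_
      push_cast
      ring)
    (by simp) (fun y hy => sub_nonneg.2 (taylor_six_le_cos hy)) hx
  exact sub_nonneg.1 key

theorem sqrt_five_bounds : 2.236067 < √5 ∧ √5 < 2.236068 := by
  constructor
  · exact Real.lt_sqrt_of_sq_lt (by norm_num)
  · rw [Real.sqrt_lt' (by norm_num)]
    norm_num

theorem sqrt_three_bounds : 1.7320508 < √3 ∧ √3 < 1.7320509 := by
  constructor
  · exact Real.lt_sqrt_of_sq_lt (by norm_num)
  · rw [Real.sqrt_lt' (by norm_num)]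
    norm_num

theorem cos_two_pi_div_five : cos (2 * π / 5) = (√5 - 1) / 4 := by
  have h5 : √5 ^ 2 = 5 := Real.sq_sqrt (by norm_num)
  rw [show 2 * π / 5 = 2 * (π / 5) by ring, cos_two_mul, cos_pi_div_five]
  linear_combination h5 / 8

theorem sin_two_pi_div_five_le : sin (2 * π / 5) ≤ 0.951058 := by
  have h := sin_sq_add_cos_sq (2 * π / 5)
  rw [cos_two_pi_div_five] at h
  have h5 : √5 ^ 2 = 5 := Real.sq_sqrt (by norm_num)
  have := sqrt_five_bounds.2
  refine (sq_le_sq₀ (sin_nonneg_of_nonneg_of_le_pi (by positivity) (by linarith [pi_pos]))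
    (by norm_num)).1 ?_
  nlinarith

theorem sqrt_one_sub_cos_side_sq : √(1 - (√5 / 3) ^ 2) = 2 / 3 := by
  rw [div_pow, Real.sq_sqrt (by norm_num), show (1 - 5 / 3 ^ 2 : ℝ) = (2 / 3) ^ 2 by norm_num]
  exact Real.sqrt_sq (by norm_num)

theorem arccos_sqrt_five_div_three_bounds :
    0.7296 < arccos (√5 / 3) ∧ arccos (√5 / 3) < 0.72974 := by
  have hs : sin (arccos (√5 / 3)) = 2 / 3 := by
    rw [sin_arccos, sqrt_one_sub_cos_side_sq]
  have h0 : 0 ≤ arccos (√5 / 3) := arccos_nonneg _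
  have h1 : arccos (√5 / 3) ≤ π / 2 := arccos_le_pi_div_two.2 (by positivity)
  have hpi := pi_gt_d6
  constructor
  · by_contra! hc
    have h2 := sin_le_sin_of_le_of_le_pi_div_two (by linarith) (by linarith) hc
    have h3 := sin_le_taylor_five (x := 0.7296) (by norm_num)
    rw [hs] at h2
    norm_num at h3 h2
    linarith
  · by_contra! hc
    have h2 := sin_le_sin_of_le_of_le_pi_div_two (by linarith) h1 hc
    have h3 := taylor_seven_le_sin (x := 0.72974) (by norm_num)
    rw [hs] at h2
    norm_num at h3 h2
    linarith

theorem p5_eq : p5 = 5 * arccos (√5 / 3) := by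
  rw [p5, cos_two_pi_div_five]
  ring_nf

theorem half_angle_eq : (π - (2 * π - π / 3) / 5) / 2 = π / 3 := by ring

theorem cos_side_eq : (cos (2 * π / 5) + cos (π / 3) ^ 2) / sin (π / 3) ^ 2 = √5 / 3 := by
  rw [cos_two_pi_div_five, cos_pi_div_three, sin_pi_div_three, div_pow √3,
    Real.sq_sqrt (by norm_num)]
  ring

theorem hasDerivAt_arccos_cos_side :
    HasDerivAt arccos (-(3 / 2)) ((cos (2 * π / 5) + cos (π / 3) ^ 2) / sin (π / 3) ^ 2) := by
  rw [cos_side_eq]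
  have := sqrt_five_bounds
  have h := hasDerivAt_arccos (x := √5 / 3) (by linarith) (by linarith)
  rw [sqrt_one_sub_cos_side_sq] at h
  exact h.congr_deriv (by norm_num)

theorem B'_eq : B' = -((√5 + 3) / (2 * √3)) := by
  have hβ : HasDerivAt (fun x : ℝ => (π - (2 * π - x) / 5) / 2) (1 / 10) (π / 3) :=
    (((((hasDerivAt_id (π / 3)).const_sub (2 * π)).div_const 5).const_sub π).div_const
      2).congr_deriv (by norm_num)
  have hs : sin ((π - (2 * π - π / 3) / 5) / 2) ^ 2 ≠ 0 := by
    rw [half_angle_eq, sin_pi_div_three]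
    positivity
  have hG := ((hβ.cos.pow 2).const_add (cos (2 * π / 5))).div (hβ.sin.pow 2) hs
  have hA : HasDerivAt arccos (-(3 / 2)) ((cos (2 * π / 5) +
      cos ((π - (2 * π - π / 3) / 5) / 2) ^ 2) / sin ((π - (2 * π - π / 3) / 5) / 2) ^ 2) := by
    rw [half_angle_eq]
    exact hasDerivAt_arccos_cos_side
  have h := (hA.comp (π / 3) hG).const_mul 5
  have hd : deriv (fun x : ℝ => regPerim x 5) (π / 3) = _ := h.deriv
  rw [B', hd]
  simp only [Pi.pow_apply, half_angle_eq, cos_two_pi_div_five, cos_pi_div_three,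
    sin_pi_div_three]
  have h3 : √3 ^ 2 = 3 := Real.sq_sqrt (by norm_num)
  field_simp
  ring_nf
  linear_combination 40 * √3 * √5 * h3

theorem p5'_eq : p5' = arccos (√5 / 3) - 4 / 5 * π * sin (2 * π / 5) +
    (√5 + 3) * π / (6 * √3) := by
  have hβ : HasDerivAt (fun n : ℝ => (π - (2 * π - π / 3) / n) / 2) (π / 30) 5 :=
    ((((hasDerivAt_const (5 : ℝ) (2 * π - π / 3)).div (hasDerivAt_id (5 : ℝ))
      (by norm_num)).const_sub π).div_const 2).congr_deriv (by simp; ring)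
  have hγ : HasDerivAt (fun n : ℝ => 2 * π / n) (-(2 * π / 25)) 5 :=
    ((hasDerivAt_const (5 : ℝ) (2 * π)).div (hasDerivAt_id (5 : ℝ))
      (by norm_num)).congr_deriv (by simp; ring)
  have hs : sin ((π - (2 * π - π / 3) / 5) / 2) ^ 2 ≠ 0 := by
    rw [half_angle_eq, sin_pi_div_three]
    positivity
  have hG := (hγ.cos.add (hβ.cos.pow 2)).div (hβ.sin.pow 2) hs
  have hA : HasDerivAt arccos (-(3 / 2)) ((cos (2 * π / 5) +
      cos ((π - (2 * π - π / 3) / 5) / 2) ^ 2) / sin ((π - (2 * π - π / 3) / 5) / 2) ^ 2) := by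
    rw [half_angle_eq]
    exact hasDerivAt_arccos_cos_side
  have h := (hasDerivAt_id (5 : ℝ)).mul (hA.comp (5 : ℝ) hG)
  have hd : deriv (fun n : ℝ => regPerim (π / 3) n) 5 = _ := h.deriv
  rw [p5', hd]
  simp only [Pi.pow_apply, Pi.add_apply, Pi.div_apply, Function.comp_apply, id_eq,
    half_angle_eq, cos_side_eq]
  simp only [cos_two_pi_div_five, cos_pi_div_three, sin_pi_div_three]
  have h3 : √3 ^ 2 = 3 := Real.sq_sqrt (by norm_num)
  have h4 : √3 ^ 3 = 3 * √3 := by rw [pow_succ, h3]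
  have h5 : √3 ^ 4 = 9 := by rw [show √3 ^ 4 = (√3 ^ 2) ^ 2 by ring, h3]; norm_num
  field_simp
  ring_nf
  simp only [h3, h4, h5]
  ring

theorem p5_lt : p5 < 3.6487 := by
  rw [p5_eq]
  linarith [arccos_sqrt_five_div_three_bounds.2]

theorem lt_B' : -1.51153 < B' := by
  rw [B'_eq, neg_lt_neg_iff, div_lt_iff₀ (by positivity)]
  linarith [sqrt_five_bounds.2, sqrt_three_bounds.1]

theorem lt_p5' : -0.07785 < p5' := by
  have h1 := arccos_sqrt_five_div_three_bounds.1
  have h2 := sin_two_pi_div_five_le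
  have h3 : 0.50384 < (√5 + 3) / (6 * √3) := by
    rw [lt_div_iff₀ (by positivity)]
    linarith [sqrt_five_bounds.1, sqrt_three_bounds.2]
  have h4 : p5' = arccos (√5 / 3) - π * (4 / 5 * sin (2 * π / 5) - (√5 + 3) / (6 * √3)) := by
    rw [p5'_eq]
    ring
  have h5 : π * (4 / 5 * sin (2 * π / 5) - (√5 + 3) / (6 * √3)) ≤ π * 0.2570064 :=
    mul_le_mul_of_nonneg_left (by linarith) pi_pos.le
  rw [h4]
  linarith [pi_lt_d6]

theorem Ifun_four_pos {ℓ t ρ : ℝ} (hρ : 0 ≤ ρ) (ht : t ≤ 0)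
    (h : 3.6487 * ρ + 0.07785 - 1.51153 * t ≤ ℓ) : 0 < Ifun ℓ 4 t ρ := by
  have h1 := mul_le_mul_of_nonneg_left p5_lt.le hρ
  have h2 := mul_le_mul_of_nonpos_left lt_B'.le ht
  have h3 := lt_p5'
  unfold Ifun
  linarith

theorem le_circPerim0 {ρ t : ℝ}
    (h : (ρ ∈ Set.Icc (0.1 : ℝ) 0.85 ∧ t ∈ Set.Icc (-1.28 : ℝ) 0) ∨
      (ρ ∈ Set.Icc (0.1 : ℝ) 1 ∧ t ∈ Set.Icc (-1.28 : ℝ) (-0.25))) :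
    3.6487 * ρ + 0.07785 - 1.51153 * t ≤ circPerim0 (ρ * π / 3 - 2 * t) := by
  have hpl := pi_gt_d6
  have hpu := pi_lt_d6
  have hb : 0.1 ≤ ρ ∧ ρ ≤ 1 ∧ -1.28 ≤ t ∧ t ≤ 0 := by
    rcases h with ⟨⟨_, _⟩, _, _⟩ | ⟨⟨_, _⟩, _, _⟩ <;> refine ⟨?_, ?_, ?_, ?_⟩ <;> linarith
  obtain ⟨hb1, hb2, hb3, hb4⟩ := hb
  set a := ρ * π / 3 - 2 * t with ha
  set b := 1.04719 * ρ - 2 * t with hb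
  have hab : b ≤ a := by rw [ha, hb]; nlinarith
  have ha4 : a ≤ 4 := by rw [ha]; nlinarith
  have hmono : b * (12.566368 - b) ≤ 4 * π * a - a ^ 2 := by
    have hb0 : 0 ≤ b := by rw [hb]; linarith
    nlinarith [mul_nonneg (sub_nonneg.2 hab) (by linarith : 0 ≤ 4 * π - a - b)]
  refine Real.le_sqrt_of_sq_le (le_trans ?_ hmono)
  rw [hb]
  rcases h with ⟨⟨h1, h2⟩, h3, h4⟩ | ⟨⟨h1, h2⟩, h3, h4⟩ <;>
  · have e1 := sub_nonneg.2 h1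
    have e2 := sub_nonneg.2 h2
    have e3 := sub_nonneg.2 h3
    have e4 := sub_nonneg.2 h4
    nlinarith [mul_nonneg e1 e2, mul_nonneg e3 e4, mul_nonneg e1 e3, mul_nonneg e1 e4,
      mul_nonneg e2 e3, mul_nonneg e2 e4]

theorem regPerim_four_eq (x : ℝ) :
    regPerim x 4 = 4 * arccos ((1 - sin (x / 4)) / (1 + sin (x / 4))) := by
  have hc : cos ((π - (2 * π - x) / 4) / 2) ^ 2 = (1 - sin (x / 4)) / 2 := by
    rw [cos_sq, show 2 * ((π - (2 * π - x) / 4) / 2) = x / 4 + π / 2 by ring, cos_add_pi_div_two]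
    ring
  have hs : sin ((π - (2 * π - x) / 4) / 2) ^ 2 = (1 + sin (x / 4)) / 2 := by
    rw [sin_sq, hc]
    ring
  rw [regPerim, hc, hs, show 2 * π / 4 = π / 2 by ring, cos_pi_div_two, zero_add,
    div_div_div_cancel_right₀ (by norm_num)]

theorem linear_le_regPerim_four {x : ℝ} (hx : x ∈ Set.Icc (0.89 : ℝ) 1.2973) :
    1.464 * x + 2.2089 ≤ regPerim x 4 := by
  obtain ⟨h1, h2⟩ := hx
  have hpi := pi_gt_d6
  have hs := sin_ge_sub_cube (x := x / 4) (by linarith)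
  have hc := taylor_six_le_cos (x := 0.366 * x + 0.552225) (by linarith)
  have hc1 := cos_le_one (0.366 * x + 0.552225)
  have hc0 : 0 ≤ cos (0.366 * x + 0.552225) :=
    cos_nonneg_of_neg_pi_div_two_le_of_le (by linarith) (by linarith)
  have hs0 : 0 ≤ sin (x / 4) := sin_nonneg_of_nonneg_of_le_pi (by linarith) (by linarith)
  have hs1 : 0 ≤ x / 4 - (x / 4) ^ 3 / 6 := by
    have hx0 : 0 ≤ x := by linarith
    have hx2 : 0 ≤ x * (2 - x) := mul_nonneg hx0 (by linarith)
    nlinarith [mul_nonneg hx2 hx0]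
  have hpoly : 1 - (x / 4 - (x / 4) ^ 3 / 6) ≤ (1 + (x / 4 - (x / 4) ^ 3 / 6)) *
      (1 - (0.366 * x + 0.552225) ^ 2 / 2 + (0.366 * x + 0.552225) ^ 4 / 24 -
        (0.366 * x + 0.552225) ^ 6 / 720) := by
    obtain ⟨θ, rfl⟩ : ∃ θ, x = 0.89 + 0.4073 * θ := ⟨(x - 0.89) / 0.4073, by ring⟩
    have t0 : 0 ≤ θ := by linarith
    have t1 : θ ≤ 1 := by linarith
    have hle : ∀ k : ℕ, θ ^ (k + 1) ≤ θ := fun k => by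
      simpa using pow_le_of_le_one t0 t1 (Nat.succ_ne_zero k)
    have g2 := hle 1
    have g3 := hle 2
    have g6 := hle 5
    have g7 := hle 6
    have g4 := pow_nonneg t0 4
    have g5 := pow_nonneg t0 5
    have g8 := pow_nonneg t0 8
    have g9 := pow_nonneg t0 9
    norm_num at g2 g3 g6 g7
    ring_nf
    linarith
  have hmain : (1 - sin (x / 4)) / (1 + sin (x / 4)) ≤ cos (0.366 * x + 0.552225) := by
    rw [div_le_iff₀ (by linarith)]
    nlinarith [mul_le_mul_of_nonneg_left hc (by linarith : 0 ≤ 1 + (x / 4 - (x / 4) ^ 3 / 6)),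
      mul_nonneg hc0 (sub_nonneg.2 hs)]
  have harc := arccos_le_arccos hmain
  rw [arccos_cos (by linarith) (by linarith)] at harc
  rw [regPerim_four_eq]
  linarith

theorem case_n4_T_nonpos :
    (∀ ρ t : ℝ,
        ((ρ ∈ Set.Icc (0.1 : ℝ) 0.85 ∧ t ∈ Set.Icc (-1.28 : ℝ) 0) ∨
         (ρ ∈ Set.Icc (0.1 : ℝ) 1 ∧ t ∈ Set.Icc (-1.28 : ℝ) (-0.25))) →
        Ifun (circPerim0 (ρ * π / 3 - 2 * t)) 4 t ρ > 0) ∧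
    (∀ ρ ∈ Set.Icc (0.85 : ℝ) 1, ∀ t ∈ Set.Icc (-0.25 : ℝ) 0,
        Ifun (regPerim (ρ * π / 3 - t) 4) 4 t ρ > 0) := by
  refine ⟨fun ρ t h => ?_, fun ρ hρ t ht => ?_⟩
  · refine Ifun_four_pos ?_ ?_ (le_circPerim0 h) <;>
      rcases h with ⟨⟨_, _⟩, _, _⟩ | ⟨⟨_, _⟩, _, _⟩ <;> linarith
  · obtain ⟨h1, h2⟩ := hρ
    obtain ⟨h3, h4⟩ := ht
    have hpl : ρ * 3.141592 ≤ ρ * π := mul_le_mul_of_nonneg_left pi_gt_d6.le (by linarith)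
    have hpu : ρ * π ≤ ρ * 3.141593 := mul_le_mul_of_nonneg_left pi_lt_d6.le (by linarith)
    have h := linear_le_regPerim_four (x := ρ * π / 3 - t) ⟨by linarith, by linarith⟩
    exact Ifun_four_pos (by linarith) h4 (by linarith)
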